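/- arXiv:2201.08703 — 3 statements merged into one kernel-verified Lean document; each statement's English description precedes it below -/
import Mathlib

section
/- Let F ∈ ℂ[x₀,…,x_n] be a homogeneous polynomial of degree 2d (d ≥ 1) defining a smooth hypersurface, i.e., the only common zero in ℂ^{n+1} of F and all of its partial derivatives ∂F/∂x₀, …, ∂F/∂x_n is the origin. If F has an expression F = Σ_{i=1}^{r} FᵢGᵢ where each Fᵢ, Gᵢ ∈ ℂ[x₀,…,x_n] is homogeneous of degree d, then 2r ≥ n + 1. -/
open MvPolynomial

/-- Every maximal ideal of a polynomial ring in finitely many variables over a field has height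
equal to the number of variables. -/
theorem MvPolynomial.height_eq_natCard_of_isMaximal {k σ : Type*} [Field k] [Finite σ]
    (M : Ideal (MvPolynomial σ k)) [hM : M.IsMaximal] : M.height = Nat.card σ := by
  induction σ using Finite.induction_empty_option with
  | of_equiv e ih =>
    let f := (renameEquiv k e).toRingEquiv
    have : (M.comap f).IsMaximal := Ideal.comap_isMaximal_of_equiv f
    rw [← f.height_comap, ih (M.comap f), Nat.card_congr e]
  | h_empty =>
    let f := (isEmptyRingEquiv k PEmpty).symm
    have : (M.comap f).IsMaximal := Ideal.comap_isMaximal_of_equiv f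
    rw [← f.height_comap, Ideal.eq_bot_of_prime (M.comap f)]
    simp
  | @h_option τ _ ih =>
    let f := (optionEquivLeft k τ).symm.toRingEquiv
    have hP : (M.comap f).IsMaximal := Ideal.comap_isMaximal_of_equiv f
    have : ((M.comap f).under (MvPolynomial τ k)).IsMaximal :=
      Polynomial.isMaximal_comap_C_of_isJacobsonRing (M.comap f)
    have : (M.comap f).LiesOver ((M.comap f).under (MvPolynomial τ k)) := ⟨rfl⟩
    rw [← f.height_comap, Polynomial.height_eq_height_add_one
      ((M.comap f).under (MvPolynomial τ k)) (M.comap f), ih]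
    simp

/-- If finitely many polynomials have exactly one common zero over an algebraically
closed field, then there are at least as many polynomials as variables. -/
theorem MvPolynomial.natCard_le_ncard_of_zeroLocus_eq_singleton {k σ : Type*} [Field k]
    [IsAlgClosed k] [Finite σ] {s : Set (MvPolynomial σ k)} (hs : s.Finite) {x : σ → k}
    (h : zeroLocus k (Ideal.span s) = {x}) : Nat.card σ ≤ s.ncard := by
  have hrad : vanishingIdeal k {x} = (Ideal.span s).radical := by
    rw [← h, vanishingIdeal_zeroLocus_eq_radical]
  have hmin : vanishingIdeal k {x} ∈ (Ideal.span s).minimalPrimes := by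
    refine ⟨⟨inferInstance, hrad ▸ Ideal.le_radical⟩, fun J hJ _ => ?_⟩
    rw [hrad]
    exact hJ.1.radical_le_iff.2 hJ.2
  have := Ideal.height_le_card_of_mem_minimalPrimes_span hs hmin
  rw [height_eq_natCard_of_isMaximal] at this
  exact_mod_cast this

theorem stmt_8 (n d r : ℕ) (hd : 1 ≤ d)
    (F : MvPolynomial (Fin (n + 1)) ℂ) (hF : F.IsHomogeneous (2 * d))
    (hsmooth : ∀ P : Fin (n + 1) → ℂ,
      eval P F = 0 → (∀ i, eval P (pderiv i F) = 0) → P = 0)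
    (Fi Gi : Fin r → MvPolynomial (Fin (n + 1)) ℂ)
    (hFi : ∀ i, (Fi i).IsHomogeneous d) (hGi : ∀ i, (Gi i).IsHomogeneous d)
    (heq : F = ∑ i, Fi i * Gi i) :
    2 * r ≥ n + 1 := by
  have hzero {p : MvPolynomial (Fin (n + 1)) ℂ} (hp : p.IsHomogeneous d) : eval 0 p = 0 := by
    rw [MvPolynomial.eval_zero]
    exact hp.coeff_eq_zero (by simp; omega)
  let s : Set (MvPolynomial (Fin (n + 1)) ℂ) := Set.range (Sum.elim Fi Gi)
  have hlocus : zeroLocus ℂ (Ideal.span s) = {0} := by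
    ext P
    simp only [zeroLocus_span, s, Set.forall_mem_range, Sum.forall, Sum.elim_inl, Sum.elim_inr,
      Set.mem_ofPred_eq, Set.mem_singleton_iff, aeval_eq_eval]
    constructor
    · rintro ⟨hf, hg⟩
      refine hsmooth P ?_ fun i => ?_
      · simp [heq, hf]
      · simp [heq, hf, hg, Derivation.leibniz]
    · rintro rfl
      exact ⟨fun i => hzero (hFi i), fun i => hzero (hGi i)⟩
  have hcard : s.ncard ≤ 2 * r := by
    simpa [s, two_mul, Set.image_univ] using
      Set.ncard_image_le (f := Sum.elim Fi Gi) (Set.finite_univ)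
  simpa using (natCard_le_ncard_of_zeroLocus_eq_singleton (Set.finite_range _) hlocus).trans hcard
end

section
/- Let F ∈ ℂ[x₀,…,x_n] be a homogeneous polynomial of degree 2d (d ≥ 1) defining a smooth hypersurface, i.e., the only common zero in ℂ^{n+1} of F and all of its partial derivatives is the origin. Suppose F = Σ_{i=1}^{r} FᵢGᵢ with each Fᵢ, Gᵢ homogeneous of degree d. Then the only common zero in ℂ^{n+1} of the 2r polynomials F₁, G₁, F₂, G₂, …, F_r, G_r is the origin. -/
open MvPolynomial

theorem stmt_9 (n d r : ℕ) (hd : 1 ≤ d)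
    (F : MvPolynomial (Fin (n + 1)) ℂ) (hF : F.IsHomogeneous (2 * d))
    (hsmooth : ∀ P : Fin (n + 1) → ℂ,
      eval P F = 0 → (∀ i, eval P (pderiv i F) = 0) → P = 0)
    (Fi Gi : Fin r → MvPolynomial (Fin (n + 1)) ℂ)
    (hFi : ∀ i, (Fi i).IsHomogeneous d) (hGi : ∀ i, (Gi i).IsHomogeneous d)
    (heq : F = ∑ i, Fi i * Gi i) :
    ∀ P : Fin (n + 1) → ℂ,
      (∀ i, eval P (Fi i) = 0 ∧ eval P (Gi i) = 0) → P = 0 := by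
  intro P hP
  refine hsmooth P ?_ fun j => ?_
  · simp [heq, hP]
  · simp [heq, hP, Derivation.leibniz]
end

section
/- In ℂ[x,y,z,t], let r = xy + i·ty + zt (where i is the imaginary unit) and Q = x² + y² + z². Then there do not exist homogeneous degree-1 polynomials l, m, a ∈ ℂ[x,y,z,t] and a scalar α ∈ ℂ such that r = l·m + a² + α·Q. -/
open MvPolynomial

/-- Evaluating a linear form is a linear function of the point. -/
theorem MvPolynomial.IsHomogeneous.exists_linearMap_eval {σ R : Type*} [CommSemiring R]
    {p : MvPolynomial σ R} (hp : p.IsHomogeneous 1) :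
    ∃ f : (σ → R) →ₗ[R] R, ∀ v, eval v p = f v := by
  rw [← mem_homogeneousSubmodule, homogeneousSubmodule_one_eq_span_X] at hp
  induction hp using Submodule.span_induction with
  | mem x hx =>
    obtain ⟨i, rfl⟩ := hx
    exact ⟨LinearMap.proj i, fun v => by simp⟩
  | zero => exact ⟨0, fun v => by simp⟩
  | add x y _ _ hx hy =>
    obtain ⟨f, hf⟩ := hx
    obtain ⟨g, hg⟩ := hy
    exact ⟨f + g, fun v => by simp [hf, hg]⟩
  | smul c x _ hx =>
    obtain ⟨f, hf⟩ := hx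
    exact ⟨c • f, fun v => by simp [hf, smul_eval]⟩

/-- Three linear functionals on a four-dimensional space have a common nontrivial zero. -/
theorem exists_ne_zero_common_zero {K : Type*} [Field K] (f g h : (Fin 4 → K) →ₗ[K] K) :
    ∃ v ≠ 0, f v = 0 ∧ g v = 0 ∧ h v = 0 := by
  have hker : LinearMap.ker (f.prod (g.prod h)) ≠ ⊥ :=
    LinearMap.ker_ne_bot_of_finrank_lt (by simp)
  obtain ⟨v, hv, hv0⟩ := Submodule.exists_mem_ne_zero_of_ne_bot hker
  refine ⟨v, hv0, ?_⟩
  simpa using hv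

theorem stmt_11 :
    ¬ ∃ (l m a : MvPolynomial (Fin 4) ℂ) (α : ℂ),
      l.IsHomogeneous 1 ∧ m.IsHomogeneous 1 ∧ a.IsHomogeneous 1 ∧
      (X 0 * X 1 + C Complex.I * (X 3 * X 1) + X 2 * X 3 : MvPolynomial (Fin 4) ℂ) =
        l * m + a ^ 2 + C α * (X 0 ^ 2 + X 1 ^ 2 + X 2 ^ 2) := by
  rintro ⟨l, m, a, α, hl, hm, ha, h⟩
  obtain ⟨f, hf⟩ := hl.exists_linearMap_eval
  obtain ⟨g, hg⟩ := hm.exists_linearMap_eval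
  obtain ⟨k, hk⟩ := ha.exists_linearMap_eval
  obtain ⟨v, hv, hfv, hgv, hkv⟩ := exists_ne_zero_common_zero f g k
  have heval (w : Fin 4 → ℂ) :
      w 0 * w 1 + Complex.I * (w 3 * w 1) + w 2 * w 3 =
        f w * g w + k w ^ 2 + α * (w 0 ^ 2 + w 1 ^ 2 + w 2 ^ 2) := by
    simpa [hf, hg, hk] using congrArg (eval w) h
  -- `v` lies in the radical of the polar form of `r - α Q`.
  have hpolar (w : Fin 4 → ℂ) :
      v 0 * w 1 + w 0 * v 1 + Complex.I * (v 3 * w 1 + w 3 * v 1) + (v 2 * w 3 + w 2 * v 3) =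
        2 * α * (v 0 * w 0 + v 1 * w 1 + v 2 * w 2) := by
    have hvw := heval (v + w)
    simp only [map_add, hfv, hgv, hkv, Pi.add_apply, zero_add] at hvw
    have hvv := heval v
    simp only [hfv, hgv, hkv] at hvv
    linear_combination hvw - hvv - heval w
  have hx := hpolar (Pi.single 0 1)
  have hy := hpolar (Pi.single 1 1)
  have hz := hpolar (Pi.single 2 1)
  have ht := hpolar (Pi.single 3 1)
  simp at hx hy hz ht
  have h0 : v 0 = 0 := by
    linear_combination hy - Complex.I * hz - 2 * α * Complex.I * ht + 2 * α * v 1 * Complex.I_sq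
  have h1 : v 1 = 0 := by linear_combination hx + 2 * α * h0
  have h2 : v 2 = 0 := by linear_combination ht - Complex.I * h1
  have h3 : v 3 = 0 := by linear_combination hz + 2 * α * h2
  apply hv
  ext i
  fin_cases i <;> assumption
end
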